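/- arXiv:2106.03268 — 2 statements merged into one kernel-verified Lean document; each statement's English description precedes it below -/
import Mathlib

section
/- Let A, B ∈ ℝ^{m×n} and suppose that (Ker T)^⊥ ∩ Ĉ2 = {0}, where (Ker T)^⊥ is the orthogonal complement in ℝ^{2n} of the kernel of T and Ĉ2 = {(u,v) ∈ ℝ^n × ℝ^n : u_i v_i = 0 for all i}. Then for every c ∈ ℝ^m, Fix(P_{C1} ∘ P_{C2}) ∩ Ω = C1 ∩ C2, where Ω = {(u,v) ∈ ℝ^n × ℝ^n : for no index i are both u_i < 0 and v_i < 0}. -/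
open scoped RealInnerProductSpace

noncomputable section

/-- The (possibly multivalued) metric projection onto a set `S`. -/
def projSet {E : Type*} [NormedAddCommGroup E] (S : Set E) (z : E) : Set E :=
  {s ∈ S | ∀ t ∈ S, ‖s - z‖ ≤ ‖t - z‖}

/-- `C2 = {(u,v) ∈ ℝⁿ × ℝⁿ : u ≥ 0, v ≥ 0, ⟨u,v⟩ = 0}`. -/
def C2set (n : ℕ) : Set (EuclideanSpace ℝ (Fin n ⊕ Fin n)) :=
  {w | (∀ i, 0 ≤ w (Sum.inl i)) ∧ (∀ i, 0 ≤ w (Sum.inr i)) ∧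
       ∑ i, w (Sum.inl i) * w (Sum.inr i) = 0}

/-- `T(u,v) = (A+B)u + (−A+B)v`. -/
def Tmap {m n : ℕ} (A B : Matrix (Fin m) (Fin n) ℝ)
    (w : EuclideanSpace ℝ (Fin n ⊕ Fin n)) : Fin m → ℝ :=
  (A + B).mulVec (fun i => w (Sum.inl i)) + (-A + B).mulVec (fun i => w (Sum.inr i))

/-- `C1 = {w : Tw = √2 c}`. -/
def C1set {m n : ℕ} (A B : Matrix (Fin m) (Fin n) ℝ) (c : Fin m → ℝ) :
    Set (EuclideanSpace ℝ (Fin n ⊕ Fin n)) :=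
  {w | Tmap A B w = Real.sqrt 2 • c}

/-- The set of fixed points of `P_{C1} ∘ P_{C2}`: points `w` such that there exists
`w' ∈ P_{C2}(w)` with `w ∈ P_{C1}(w')`. -/
def FixSet {m n : ℕ} (A B : Matrix (Fin m) (Fin n) ℝ) (c : Fin m → ℝ) :
    Set (EuclideanSpace ℝ (Fin n ⊕ Fin n)) :=
  {w | ∃ w' ∈ projSet (C2set n) w, w ∈ projSet (C1set A B c) w'}

/-- `Ω = {(u,v) : for no i are both u_i < 0 and v_i < 0}`. -/
def OmegaSet (n : ℕ) : Set (EuclideanSpace ℝ (Fin n ⊕ Fin n)) :=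
  {w | ∀ i, ¬(w (Sum.inl i) < 0 ∧ w (Sum.inr i) < 0)}

/-- If `‖d‖` is minimal along the line `d + ℝ z`, then `d` is orthogonal to `z`. -/
lemma inner_eq_zero_of_forall_norm_le_norm_add_smul {E : Type*} [NormedAddCommGroup E]
    [InnerProductSpace ℝ E] {d z : E} (h : ∀ t : ℝ, ‖d‖ ≤ ‖d + t • z‖) : ⟪d, z⟫ = 0 := by
  have hquad (t : ℝ) : 0 ≤ 2 * (t * ⟪d, z⟫) + t ^ 2 * ‖z‖ ^ 2 := by
    have hsq := pow_le_pow_left₀ (norm_nonneg d) (h t) 2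
    rw [norm_add_sq_real, real_inner_smul_right, norm_smul, mul_pow, Real.norm_eq_abs,
      sq_abs] at hsq
    linarith
  have hdisc := discrim_le_zero (a := ‖z‖ ^ 2) (b := 2 * ⟪d, z⟫) (c := 0)
    fun t => by linarith [hquad t]
  unfold discrim at hdisc
  nlinarith [sq_nonneg ⟪d, z⟫]

lemma mem_projSet_self {E : Type*} [NormedAddCommGroup E] {S : Set E} {z : E} (hz : z ∈ S) :
    z ∈ projSet S z :=
  ⟨hz, fun t _ => by simp⟩

lemma Tmap_add_smul {m n : ℕ} (A B : Matrix (Fin m) (Fin n) ℝ)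
    (w z : EuclideanSpace ℝ (Fin n ⊕ Fin n)) (t : ℝ) :
    Tmap A B (w + t • z) = Tmap A B w + t • Tmap A B z := by
  have hsplit (f : Fin n → Fin n ⊕ Fin n) :
      (fun i => (w + t • z) (f i)) = (fun i => w (f i)) + t • fun i => z (f i) := by
    ext i; simp
  simp only [Tmap, hsplit, Matrix.mulVec_add, Matrix.mulVec_smul, smul_add]
  abel

/-- The residual of the projection onto `C1` is orthogonal to the kernel of `T`. -/
lemma inner_sub_eq_zero_of_mem_projSet_C1set {m n : ℕ} {A B : Matrix (Fin m) (Fin n) ℝ}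
    {c : Fin m → ℝ} {w w' z : EuclideanSpace ℝ (Fin n ⊕ Fin n)}
    (hw : w ∈ projSet (C1set A B c) w') (hz : Tmap A B z = 0) : ⟪w - w', z⟫ = 0 := by
  refine inner_eq_zero_of_forall_norm_le_norm_add_smul fun t => ?_
  have hmem : w + t • z ∈ C1set A B c := by
    have hw1 : Tmap A B w = Real.sqrt 2 • c := hw.1
    simp [C1set, Tmap_add_smul, hz, hw1]
  have hle := hw.2 _ hmem
  rwa [add_sub_right_comm] at hle

lemma mul_eq_zero_of_mem_C2set {n : ℕ} {w : EuclideanSpace ℝ (Fin n ⊕ Fin n)}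
    (hw : w ∈ C2set n) (i : Fin n) : w (Sum.inl i) * w (Sum.inr i) = 0 :=
  (Finset.sum_eq_zero_iff_of_nonneg fun j _ => mul_nonneg (hw.1 j) (hw.2.1 j)).1 hw.2.2 i
    (Finset.mem_univ i)

/-- A projection onto `C2` is optimal in each pair of coordinates. -/
lemma sq_add_sq_le_of_mem_projSet_C2set {n : ℕ} {w w' : EuclideanSpace ℝ (Fin n ⊕ Fin n)}
    (hw' : w' ∈ projSet (C2set n) w) (i : Fin n) {a b : ℝ} (ha : 0 ≤ a) (hb : 0 ≤ b)
    (hab : a * b = 0) :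
    (w' (Sum.inl i) - w (Sum.inl i)) ^ 2 + (w' (Sum.inr i) - w (Sum.inr i)) ^ 2 ≤
      (a - w (Sum.inl i)) ^ 2 + (b - w (Sum.inr i)) ^ 2 := by
  let s : EuclideanSpace ℝ (Fin n ⊕ Fin n) := WithLp.toLp 2 (Sum.elim
    (Function.update (fun j => w' (Sum.inl j)) i a)
    (Function.update (fun j => w' (Sum.inr j)) i b))
  have hsl (j : Fin n) : s (Sum.inl j) = if j = i then a else w' (Sum.inl j) := by
    simp [s, Function.update_apply]
  have hsr (j : Fin n) : s (Sum.inr j) = if j = i then b else w' (Sum.inr j) := by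
    simp [s, Function.update_apply]
  have hs : s ∈ C2set n := by
    refine ⟨fun j => ?_, fun j => ?_, Finset.sum_eq_zero fun j _ => ?_⟩
    · rw [hsl]; split_ifs
      exacts [ha, hw'.1.1 j]
    · rw [hsr]; split_ifs
      exacts [hb, hw'.1.2.1 j]
    · rw [hsl, hsr]; split_ifs
      exacts [hab, mul_eq_zero_of_mem_C2set hw'.1 j]
  have hle := pow_le_pow_left₀ (norm_nonneg _) (hw'.2 s hs) 2
  simp only [EuclideanSpace.norm_sq_eq, Fintype.sum_sum_type, PiLp.sub_apply, Real.norm_eq_abs,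
    sq_abs, ← Finset.sum_add_distrib] at hle
  rw [← Finset.add_sum_erase _ _ (Finset.mem_univ i),
    ← Finset.add_sum_erase _ _ (Finset.mem_univ i)] at hle
  have hrest : ∑ j ∈ Finset.univ.erase i, ((s (Sum.inl j) - w (Sum.inl j)) ^ 2 +
        (s (Sum.inr j) - w (Sum.inr j)) ^ 2) =
      ∑ j ∈ Finset.univ.erase i, ((w' (Sum.inl j) - w (Sum.inl j)) ^ 2 +
        (w' (Sum.inr j) - w (Sum.inr j)) ^ 2) :=
    Finset.sum_congr rfl fun j hj => by
      rw [hsl, hsr, if_neg (Finset.ne_of_mem_erase hj), if_neg (Finset.ne_of_mem_erase hj)]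
  rw [hrest, hsl, hsr, if_pos rfl, if_pos rfl] at hle
  linarith

/-- Projecting onto the half-line `[0, ∞) × {0}` a point outside the open negative quadrant moves
at most one coordinate, provided no point of `{0} × [0, ∞)` is strictly closer. -/
lemma sub_eq_zero_or_eq_zero_of_sq_le {u v p : ℝ} (hp : 0 ≤ p) (huv : ¬(u < 0 ∧ v < 0))
    (hmin : ∀ a b : ℝ, 0 ≤ a → 0 ≤ b → a * b = 0 →
      (p - u) ^ 2 + v ^ 2 ≤ (a - u) ^ 2 + (b - v) ^ 2) : p - u = 0 ∨ v = 0 := by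
  rcases le_or_gt 0 u with hu | hu
  · have h := hmin u 0 hu le_rfl (mul_zero u)
    left
    nlinarith [sq_nonneg (p - u)]
  · have hv : 0 ≤ v := not_lt.1 fun hv => huv ⟨hu, hv⟩
    have h := hmin 0 v le_rfl hv (zero_mul v)
    right
    nlinarith [sq_nonneg v, mul_nonneg hp (neg_nonneg.2 hu.le)]

/-- On `Ω`, the residual of the projection onto `C2` vanishes in one coordinate of each pair. -/
lemma sub_mul_sub_eq_zero_of_mem_projSet_C2set {n : ℕ}
    {w w' : EuclideanSpace ℝ (Fin n ⊕ Fin n)} (hw' : w' ∈ projSet (C2set n) w)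
    (hw : w ∈ OmegaSet n) (i : Fin n) :
    (w' (Sum.inl i) - w (Sum.inl i)) * (w' (Sum.inr i) - w (Sum.inr i)) = 0 := by
  have hmin := fun a b => sq_add_sq_le_of_mem_projSet_C2set hw' i (a := a) (b := b)
  rcases mul_eq_zero.1 (mul_eq_zero_of_mem_C2set hw'.1 i) with h | h
  · rw [h] at hmin ⊢
    rcases sub_eq_zero_or_eq_zero_of_sq_le (hw'.1.2.1 i) (fun hneg => hw i hneg.symm)
      (fun a b ha hb hab => by linarith [hmin b a hb ha (by rw [mul_comm, hab])]) with h0 | h0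
    all_goals simp [h0]
  · rw [h] at hmin ⊢
    rcases sub_eq_zero_or_eq_zero_of_sq_le (hw'.1.1 i) (hw i)
      (fun a b ha hb hab => by linarith [hmin a b ha hb hab]) with h0 | h0
    all_goals simp [h0]

theorem fixed_points_characterization_arbitrary {m n : ℕ}
    (A B : Matrix (Fin m) (Fin n) ℝ)
    (hker : ∀ w : EuclideanSpace ℝ (Fin n ⊕ Fin n),
      (∀ z : EuclideanSpace ℝ (Fin n ⊕ Fin n), Tmap A B z = 0 → ⟪w, z⟫ = 0) →
      (∀ i, w (Sum.inl i) * w (Sum.inr i) = 0) → w = 0) :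
    ∀ c : Fin m → ℝ, FixSet A B c ∩ OmegaSet n = C1set A B c ∩ C2set n := by
  intro c
  ext w
  constructor
  · rintro ⟨⟨w', hw', hw⟩, hΩ⟩
    have hsub : w - w' = 0 := by
      refine hker _ (fun z hz => inner_sub_eq_zero_of_mem_projSet_C1set hw hz) fun i => ?_
      simp only [PiLp.sub_apply]
      linarith [sub_mul_sub_eq_zero_of_mem_projSet_C2set hw' hΩ i]
    obtain rfl := sub_eq_zero.1 hsub
    exact ⟨hw.1, hw'.1⟩
  · rintro ⟨h1, h2⟩
    exact ⟨⟨w, mem_projSet_self h2, mem_projSet_self h1⟩, fun i hi => (h2.1 i).not_gt hi.1⟩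
end
end

section
/- Let A, B ∈ ℝ^{m×n}, c ∈ ℝ^m, and let (w^k) = ((u^k, v^k)) be any sequence with w^{k+1} ∈ P_{C1}(P_{C2}(w^k)) for all k. Suppose w* = (u*, v*) ∈ C1 ∩ C2, and define I1* = {i : u*_i > v*_i = 0}, I2* = {i : 0 = u*_i < v*_i}, and Γ* = {(u,v) ∈ ℝ^n × ℝ^n : (u_i, v_i) ∈ K1 for all i ∈ I1*, and (u_i, v_i) ∈ K2 for all i ∈ I2*}. If w^k ∈ Γ* for all sufficiently large k, then Ψ(w^k) → 0 as k → ∞, and there exists a point w̄ ∈ C1 ∩ C2 such that w^k → w̄ as k → ∞. -/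
noncomputable section

/-- `K1 = {(a,b) : a > b or a = b ≤ 0}`. -/
def K1 (a b : ℝ) : Prop := a > b ∨ (a = b ∧ a ≤ 0)

/-- `K2 = {(a,b) : a < b or a = b ≤ 0}`. -/
def K2 (a b : ℝ) : Prop := a < b ∨ (a = b ∧ a ≤ 0)

/-- `ψ(s,t) = min(s,t)²/2 + max(−max(s,t), 0)²/2`. -/
def psi (s t : ℝ) : ℝ := min s t ^ 2 / 2 + max (-(max s t)) 0 ^ 2 / 2

/-- `Ψ(u,v) = Σᵢ ψ(uᵢ, vᵢ)`. -/
def PsiFun {n : ℕ} (w : EuclideanSpace ℝ (Fin n ⊕ Fin n)) : ℝ :=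
  ∑ i, psi (w (Sum.inl i)) (w (Sum.inr i))

/-- `Γ* = {(u,v) : (uᵢ,vᵢ) ∈ K1 for i ∈ I1*, (uᵢ,vᵢ) ∈ K2 for i ∈ I2*}`,
where `I1* = {i : u*ᵢ > v*ᵢ = 0}` and `I2* = {i : 0 = u*ᵢ < v*ᵢ}`. -/
def GammaStar {n : ℕ} (wstar : EuclideanSpace ℝ (Fin n ⊕ Fin n)) :
    Set (EuclideanSpace ℝ (Fin n ⊕ Fin n)) :=
  {w | ∀ i,
    ((wstar (Sum.inr i) = 0 ∧ wstar (Sum.inr i) < wstar (Sum.inl i)) →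
      K1 (w (Sum.inl i)) (w (Sum.inr i))) ∧
    ((wstar (Sum.inl i) = 0 ∧ wstar (Sum.inl i) < wstar (Sum.inr i)) →
      K2 (w (Sum.inl i)) (w (Sum.inr i)))}

open Filter Topology

lemma K2.symm {a b : ℝ} (h : K2 a b) : K1 b a :=
  h.imp id fun ⟨h₁, h₂⟩ => ⟨h₁.symm, h₁ ▸ h₂⟩

/-- A nearest point to `a` among the nonnegative reals is the positive part of `a`. -/
lemma eq_max_of_nearest_nonneg {a y : ℝ} (hy : 0 ≤ y)
    (hmin : ∀ p, 0 ≤ p → (y - a) ^ 2 ≤ (p - a) ^ 2) : y = max a 0 := by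
  rcases le_total a 0 with ha | ha
  · have := hmin 0 le_rfl
    rw [max_eq_right ha]
    nlinarith
  · have := hmin a ha
    rw [max_eq_left ha]
    nlinarith [sq_nonneg (y - a)]

/-- Pythagorean inequality for the projection onto the complementarity set of the plane,
relative to the origin. -/
lemma planar_pythagoras_zero {a b y z : ℝ} (hy : 0 ≤ y) (hz : 0 ≤ z) (hyz : y * z = 0)
    (hmin : ∀ p q, 0 ≤ p → 0 ≤ q → p * q = 0 →
      (y - a) ^ 2 + (z - b) ^ 2 ≤ (p - a) ^ 2 + (q - b) ^ 2) :
    y ^ 2 + z ^ 2 + ((a - y) ^ 2 + (b - z) ^ 2) ≤ a ^ 2 + b ^ 2 := by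
  rcases mul_eq_zero.1 hyz with rfl | rfl
  · have h := eq_max_of_nearest_nonneg (a := b) hz fun q hq => by
      linarith [hmin 0 q le_rfl hq (zero_mul q)]
    rcases max_cases b 0 with ⟨h', _⟩ | ⟨h', _⟩ <;> rw [h'] at h <;> subst h <;> nlinarith
  · have h := eq_max_of_nearest_nonneg (a := a) hy fun p hp => by
      linarith [hmin p 0 hp le_rfl (mul_zero p)]
    rcases max_cases a 0 with ⟨h', _⟩ | ⟨h', _⟩ <;> rw [h'] at h <;> subst h <;> nlinarith

/-- Pythagorean inequality for the projection onto the complementarity set of the plane,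
relative to a point of the first half-axis. -/
lemma planar_pythagoras_of_K1 {a b y z s : ℝ} (hs : 0 ≤ s) (hK : K1 a b)
    (hy : 0 ≤ y) (hz : 0 ≤ z) (hyz : y * z = 0)
    (hmin : ∀ p q, 0 ≤ p → 0 ≤ q → p * q = 0 →
      (y - a) ^ 2 + (z - b) ^ 2 ≤ (p - a) ^ 2 + (q - b) ^ 2) :
    (y - s) ^ 2 + z ^ 2 + ((a - y) ^ 2 + (b - z) ^ 2) ≤ (a - s) ^ 2 + b ^ 2 := by
  have hz0 : z = 0 := by
    rcases mul_eq_zero.1 hyz with rfl | h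
    · have h := eq_max_of_nearest_nonneg (a := b) hz fun q hq => by
        linarith [hmin 0 q le_rfl hq (zero_mul q)]
      rcases max_cases b 0 with ⟨h', hb⟩ | ⟨h', hb⟩
      · rw [h'] at h
        subst h
        rcases hK with hK | ⟨rfl, hK⟩
        · nlinarith [hmin a 0 (by linarith) le_rfl (mul_zero a)]
        · linarith
      · exact h.trans h'
    · exact h
  subst hz0
  have h := eq_max_of_nearest_nonneg (a := a) hy fun p hp => by
    linarith [hmin p 0 hp le_rfl (mul_zero p)]
  rcases max_cases a 0 with ⟨h', _⟩ | ⟨h', _⟩ <;> rw [h'] at h <;> subst h <;> nlinarith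

/-- `ψ` is at most half the squared distance to any point of the complementarity set. -/
lemma psi_le {a b p q : ℝ} (hp : 0 ≤ p) (hq : 0 ≤ q) (hpq : p * q = 0) :
    psi a b ≤ ((a - p) ^ 2 + (b - q) ^ 2) / 2 := by
  unfold psi
  rcases mul_eq_zero.1 hpq with rfl | rfl <;> rcases le_total a b with h | h <;>
    simp only [min_eq_left, min_eq_right, max_eq_left, max_eq_right, h]
  · rcases max_cases (-b) 0 with ⟨h', _⟩ | ⟨h', _⟩ <;> rw [h'] <;> nlinarith
  · rcases max_cases (-a) 0 with ⟨h', _⟩ | ⟨h', _⟩ <;> rw [h']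
    · nlinarith
    · rcases le_total 0 b with hb | hb <;> nlinarith
  · rcases max_cases (-b) 0 with ⟨h', _⟩ | ⟨h', _⟩ <;> rw [h']
    · nlinarith
    · rcases le_total 0 a with hb | hb <;> nlinarith
  · rcases max_cases (-a) 0 with ⟨h', _⟩ | ⟨h', _⟩ <;> rw [h'] <;> nlinarith

lemma psi_nonneg (a b : ℝ) : 0 ≤ psi a b := by unfold psi; positivity

lemma PsiFun_nonneg {n : ℕ} (x : EuclideanSpace ℝ (Fin n ⊕ Fin n)) : 0 ≤ PsiFun x :=
  Finset.sum_nonneg fun _ _ => psi_nonneg _ _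

lemma norm_sub_sq_eq_sum_pairs {n : ℕ} (x y : EuclideanSpace ℝ (Fin n ⊕ Fin n)) :
    ‖x - y‖ ^ 2 = ∑ i, ((x (Sum.inl i) - y (Sum.inl i)) ^ 2
      + (x (Sum.inr i) - y (Sum.inr i)) ^ 2) := by
  rw [EuclideanSpace.real_norm_sq_eq, Fintype.sum_sum_type, Finset.sum_add_distrib]
  simp

lemma mem_C2set_iff {n : ℕ} {x : EuclideanSpace ℝ (Fin n ⊕ Fin n)} :
    x ∈ C2set n ↔
      ∀ i, 0 ≤ x (Sum.inl i) ∧ 0 ≤ x (Sum.inr i) ∧ x (Sum.inl i) * x (Sum.inr i) = 0 := by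
  constructor
  · rintro ⟨h₁, h₂, h₃⟩ i
    rw [Finset.sum_eq_zero_iff_of_nonneg fun i _ => mul_nonneg (h₁ i) (h₂ i)] at h₃
    exact ⟨h₁ i, h₂ i, h₃ i (Finset.mem_univ i)⟩
  · intro h
    exact ⟨fun i => (h i).1, fun i => (h i).2.1, Finset.sum_eq_zero fun i _ => (h i).2.2⟩

lemma isClosed_C2set (n : ℕ) : IsClosed (C2set n) := by
  have : C2set n = ⋂ i, {x | 0 ≤ x (Sum.inl i) ∧ 0 ≤ x (Sum.inr i) ∧
      x (Sum.inl i) * x (Sum.inr i) = 0} := by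
    ext x
    simp [mem_C2set_iff]
  rw [this]
  refine isClosed_iInter fun i => ?_
  have hl : Continuous fun x : EuclideanSpace ℝ (Fin n ⊕ Fin n) => x (Sum.inl i) := by fun_prop
  have hr : Continuous fun x : EuclideanSpace ℝ (Fin n ⊕ Fin n) => x (Sum.inr i) := by fun_prop
  exact (isClosed_le continuous_const hl).inter
    ((isClosed_le continuous_const hr).inter (isClosed_eq (hl.mul hr) continuous_const))

lemma isClosed_C1set {m n : ℕ} (A B : Matrix (Fin m) (Fin n) ℝ) (c : Fin m → ℝ) :
    IsClosed (C1set A B c) := by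
  have hl : Continuous fun (x : EuclideanSpace ℝ (Fin n ⊕ Fin n)) i => x (Sum.inl i) := by
    fun_prop
  have hr : Continuous fun (x : EuclideanSpace ℝ (Fin n ⊕ Fin n)) i => x (Sum.inr i) := by
    fun_prop
  exact isClosed_eq ((continuous_const.matrix_mulVec hl).add (continuous_const.matrix_mulVec hr))
    continuous_const

lemma Tmap_add_smul_sub {m n : ℕ} (A B : Matrix (Fin m) (Fin n) ℝ)
    (x y : EuclideanSpace ℝ (Fin n ⊕ Fin n)) (t : ℝ) :
    Tmap A B (x + t • (y - x)) = Tmap A B x + t • (Tmap A B y - Tmap A B x) := by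
  have h (M : Matrix (Fin m) (Fin n) ℝ) (f g : Fin n → ℝ) :
      M.mulVec (fun i => f i + t * (g i - f i)) =
        M.mulVec f + t • (M.mulVec g - M.mulVec f) := by
    rw [← Matrix.mulVec_sub, ← Matrix.mulVec_smul, ← Matrix.mulVec_add]
    rfl
  simp only [Tmap, PiLp.add_apply, PiLp.smul_apply, PiLp.sub_apply, smul_eq_mul, h]
  module

/-- A projection onto a set closed under taking affine lines is nonexpansive relative to the
points of the set. -/
lemma norm_sub_le_of_mem_projSet {E : Type*} [NormedAddCommGroup E] [InnerProductSpace ℝ E]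
    {S : Set E} (hS : ∀ x ∈ S, ∀ y ∈ S, ∀ t : ℝ, x + t • (y - x) ∈ S)
    {y p w : E} (hp : p ∈ projSet S y) (hw : w ∈ S) : ‖p - w‖ ≤ ‖y - w‖ := by
  have key : ∀ t : ℝ, 0 ≤ ‖w - p‖ ^ 2 * (t * t) + 2 * inner ℝ (p - y) (w - p) * t + 0 := by
    intro t
    have h := hp.2 _ (hS p hp.1 w hw t)
    have e : p + t • (w - p) - y = (p - y) + t • (w - p) := by abel
    rw [e] at h
    have h2 := pow_le_pow_left₀ (norm_nonneg _) h 2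
    rw [norm_add_sq_real, inner_smul_right, norm_smul, mul_pow, Real.norm_eq_abs, sq_abs] at h2
    linarith
  have hd := discrim_le_zero key
  have hI : (inner ℝ (p - y) (w - p) : ℝ) = 0 := by
    unfold discrim at hd
    nlinarith
  refine le_of_sq_le_sq ?_ (norm_nonneg _)
  have e : y - w = -((p - y) + (w - p)) := by abel
  rw [e, norm_neg, norm_add_sq_real, hI, norm_sub_rev p w]
  nlinarith [sq_nonneg ‖p - y‖]

/-- The projection onto `C2` is computed coordinate pair by coordinate pair. -/
lemma projSet_C2set_pair {n : ℕ} {x y : EuclideanSpace ℝ (Fin n ⊕ Fin n)}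
    (hy : y ∈ projSet (C2set n) x) (i : Fin n) (p q : ℝ) (hp : 0 ≤ p) (hq : 0 ≤ q)
    (hpq : p * q = 0) :
    (y (Sum.inl i) - x (Sum.inl i)) ^ 2 + (y (Sum.inr i) - x (Sum.inr i)) ^ 2
      ≤ (p - x (Sum.inl i)) ^ 2 + (q - x (Sum.inr i)) ^ 2 := by
  have hyC := mem_C2set_iff.1 hy.1
  let t : EuclideanSpace ℝ (Fin n ⊕ Fin n) := WithLp.toLp 2 (Sum.elim
    (Function.update (fun j => y (Sum.inl j)) i p)
    (Function.update (fun j => y (Sum.inr j)) i q))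
  have ht_inl (j) : t (Sum.inl j) = Function.update (fun j => y (Sum.inl j)) i p j := rfl
  have ht_inr (j) : t (Sum.inr j) = Function.update (fun j => y (Sum.inr j)) i q j := rfl
  have htC : t ∈ C2set n := by
    refine mem_C2set_iff.2 fun j => ?_
    rw [ht_inl, ht_inr]
    rcases eq_or_ne j i with rfl | hj
    · simpa using ⟨hp, hq, mul_eq_zero.1 hpq⟩
    · simpa only [Function.update_of_ne hj] using hyC j
  have h := pow_le_pow_left₀ (norm_nonneg _) (hy.2 t htC) 2
  rw [norm_sub_sq_eq_sum_pairs, norm_sub_sq_eq_sum_pairs,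
    ← Finset.add_sum_erase _ _ (Finset.mem_univ i),
    ← Finset.add_sum_erase _ _ (Finset.mem_univ i)] at h
  rw [Finset.sum_congr rfl (g := fun j => (y (Sum.inl j) - x (Sum.inl j)) ^ 2
    + (y (Sum.inr j) - x (Sum.inr j)) ^ 2) (s₁ := Finset.univ.erase i) (fun j hj => by
      rw [ht_inl, ht_inr, Function.update_of_ne (Finset.ne_of_mem_erase hj),
        Function.update_of_ne (Finset.ne_of_mem_erase hj)]) (f := fun j =>
      (t (Sum.inl j) - x (Sum.inl j)) ^ 2 + (t (Sum.inr j) - x (Sum.inr j)) ^ 2)] at h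
  rw [ht_inl, ht_inr, Function.update_self, Function.update_self] at h
  linarith

/-- Pythagorean inequality for the projection onto `C2` of a point of `Γ*`. -/
lemma pythagoras_of_mem_GammaStar {n : ℕ} {x y z : EuclideanSpace ℝ (Fin n ⊕ Fin n)}
    (hz : z ∈ C2set n) (hx : x ∈ GammaStar z) (hy : y ∈ projSet (C2set n) x) :
    ‖y - z‖ ^ 2 + ‖x - y‖ ^ 2 ≤ ‖x - z‖ ^ 2 := by
  simp only [norm_sub_sq_eq_sum_pairs, ← Finset.sum_add_distrib]
  refine Finset.sum_le_sum fun i _ => ?_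
  obtain ⟨hz₁, hz₂, hz₃⟩ := mem_C2set_iff.1 hz i
  obtain ⟨hy₁, hy₂, hy₃⟩ := mem_C2set_iff.1 hy.1 i
  have hmin := projSet_C2set_pair hy i
  rcases mul_eq_zero.1 hz₃ with h | h
  · rcases hz₂.eq_or_lt with h' | h'
    · rw [h, ← h']
      simpa using planar_pythagoras_zero hy₁ hy₂ hy₃ hmin
    · have := planar_pythagoras_of_K1 hz₂ ((hx i).2 ⟨h, h ▸ h'⟩).symm hy₂ hy₁
        (by rwa [mul_comm]) fun p q hp hq hpq => by
          linarith [hmin q p hq hp (by rwa [mul_comm])]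
      rw [h]
      linarith
  · rcases hz₁.eq_or_lt with h' | h'
    · rw [h, ← h']
      simpa using planar_pythagoras_zero hy₁ hy₂ hy₃ hmin
    · have := planar_pythagoras_of_K1 hz₁ ((hx i).1 ⟨h, h ▸ h'⟩) hy₁ hy₂ hy₃ hmin
      rw [h]
      linarith

lemma PsiFun_le_of_mem_C2set {n : ℕ} {x y : EuclideanSpace ℝ (Fin n ⊕ Fin n)}
    (hy : y ∈ C2set n) : PsiFun x ≤ ‖x - y‖ ^ 2 / 2 := by
  rw [norm_sub_sq_eq_sum_pairs, Finset.sum_div]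
  refine Finset.sum_le_sum fun i _ => ?_
  obtain ⟨h₁, h₂, h₃⟩ := mem_C2set_iff.1 hy i
  exact psi_le h₁ h₂ h₃

lemma eventually_mem_GammaStar {n : ℕ} (z : EuclideanSpace ℝ (Fin n ⊕ Fin n)) :
    ∀ᶠ x in 𝓝 z, x ∈ GammaStar z := by
  refine eventually_all.2 fun i => ?_
  have hl : Tendsto (fun x : EuclideanSpace ℝ (Fin n ⊕ Fin n) => x (Sum.inl i)) (𝓝 z)
    (𝓝 (z (Sum.inl i))) := Continuous.tendsto (by fun_prop) z
  have hr : Tendsto (fun x : EuclideanSpace ℝ (Fin n ⊕ Fin n) => x (Sum.inr i)) (𝓝 z)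
    (𝓝 (z (Sum.inr i))) := Continuous.tendsto (by fun_prop) z
  refine Eventually.and ?_ ?_ <;> refine eventually_imp_distrib_left.2 fun h => ?_
  · filter_upwards [hr.eventually_lt hl h.2] with x hx using Or.inl hx
  · filter_upwards [hl.eventually_lt hr h.2] with x hx using Or.inl hx

theorem MAP_convergence_in_GammaStar {m n : ℕ}
    (A B : Matrix (Fin m) (Fin n) ℝ) (c : Fin m → ℝ)
    (w : ℕ → EuclideanSpace ℝ (Fin n ⊕ Fin n))
    (hmap : ∀ k, ∃ w' ∈ projSet (C2set n) (w k), w (k + 1) ∈ projSet (C1set A B c) w')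
    (wstar : EuclideanSpace ℝ (Fin n ⊕ Fin n))
    (hstar : wstar ∈ C1set A B c ∩ C2set n)
    (hGamma : ∃ N : ℕ, ∀ k ≥ N, w k ∈ GammaStar wstar) :
    Filter.Tendsto (fun k => PsiFun (w k)) Filter.atTop (nhds 0) ∧
    ∃ wbar ∈ C1set A B c ∩ C2set n, Filter.Tendsto w Filter.atTop (nhds wbar) := by
  choose y hy hw using hmap
  obtain ⟨N, hN⟩ := hGamma
  have hC1 : ∀ x ∈ C1set A B c, ∀ y ∈ C1set A B c, ∀ t : ℝ, x + t • (y - x) ∈ C1set A B c := by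
    intro x hx y hy t
    simp only [C1set, Set.mem_ofPred_eq] at hx hy ⊢
    rw [Tmap_add_smul_sub, hx, hy, sub_self, smul_zero, add_zero]
  have step : ∀ z ∈ C1set A B c ∩ C2set n, ∀ k, w k ∈ GammaStar z →
      ‖w (k + 1) - z‖ ^ 2 + ‖w k - y k‖ ^ 2 ≤ ‖w k - z‖ ^ 2 := by
    intro z hz k hk
    have h₁ := pythagoras_of_mem_GammaStar hz.2 hk (hy k)
    have h₂ := pow_le_pow_left₀ (norm_nonneg _) (norm_sub_le_of_mem_projSet hC1 (hw k) hz.1) 2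
    linarith
  have step_le : ∀ z ∈ C1set A B c ∩ C2set n, ∀ k, w k ∈ GammaStar z →
      ‖w (k + 1) - z‖ ≤ ‖w k - z‖ := fun z hz k hk =>
    le_of_sq_le_sq (by nlinarith [step z hz k hk, sq_nonneg ‖w k - y k‖]) (norm_nonneg _)
  set a : ℕ → ℝ := fun k => ‖w (k + N) - wstar‖ ^ 2 with ha
  have a_step (k) : a (k + 1) + ‖w (k + N) - y (k + N)‖ ^ 2 ≤ a k := by
    have := step wstar hstar (k + N) (hN _ (by omega))
    rwa [show k + N + 1 = k + 1 + N by omega] at this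
  have a_anti : Antitone a := antitone_nat_of_succ_le fun k => by
    linarith [a_step k, sq_nonneg ‖w (k + N) - y (k + N)‖]
  have a_lim : Tendsto a atTop (𝓝 (⨅ k, a k)) :=
    tendsto_atTop_ciInf a_anti ⟨0, by rintro _ ⟨k, rfl⟩; positivity⟩
  have a_diff : Tendsto (fun k => a k - a (k + 1)) atTop (𝓝 0) := by
    simpa using a_lim.sub (a_lim.comp (tendsto_add_atTop_nat 1))
  have hres : Tendsto (fun k => ‖w k - y k‖ ^ 2) atTop (𝓝 0) := by
    rw [← tendsto_add_atTop_iff_nat N]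
    exact squeeze_zero (fun k => sq_nonneg _) (fun k => by linarith [a_step k]) a_diff
  refine ⟨squeeze_zero (fun k => PsiFun_nonneg _)
    (fun k => PsiFun_le_of_mem_C2set (hy k).1) (by simpa using hres.div_const 2), ?_⟩
  have hsub : Tendsto (fun k => w k - y k) atTop (𝓝 0) := by
    rw [tendsto_zero_iff_norm_tendsto_zero]
    simpa [Real.sqrt_sq (norm_nonneg _)] using hres.sqrt
  have hbdd (k) : w (k + 1 + N) ∈ Metric.closedBall wstar (Real.sqrt (a 0)) := by
    rw [mem_closedBall_iff_norm]
    exact Real.le_sqrt_of_sq_le (a_anti (Nat.zero_le (k + 1)))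
  obtain ⟨wbar, -, φ, hφ, hlim⟩ :=
    tendsto_subseq_of_bounded Metric.isBounded_closedBall hbdd
  have hidx : Tendsto (fun j => φ j + 1 + N) atTop atTop :=
    tendsto_atTop_mono (fun j => (hφ.id_le j).trans (show φ j ≤ φ j + 1 + N by omega)) tendsto_id
  have hmem : wbar ∈ C1set A B c ∩ C2set n := by
    constructor
    · refine (isClosed_C1set A B c).mem_of_tendsto hlim (Eventually.of_forall fun j => ?_)
      have := (hw (φ j + N)).1
      rwa [show φ j + N + 1 = φ j + 1 + N by omega] at this
    · refine (isClosed_C2set n).mem_of_tendsto (f := fun j => y (φ j + 1 + N)) (b := atTop) ?_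
        (Eventually.of_forall fun j => (hy _).1)
      simpa using hlim.sub (hsub.comp hidx)
  refine ⟨wbar, hmem, ?_⟩
  obtain ⟨ε, hε, hball⟩ := Metric.eventually_nhds_iff_ball.1 (eventually_mem_GammaStar wbar)
  refine Metric.tendsto_atTop.2 fun δ hδ => ?_
  obtain ⟨j, hj⟩ := (hlim.eventually (Metric.ball_mem_nhds wbar (lt_min hε hδ))).exists
  refine ⟨φ j + 1 + N, fun k hk => ?_⟩
  suffices w k ∈ Metric.ball wbar (min ε δ) from (Metric.mem_ball.1 this).trans_le (min_le_right _ _)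
  induction k, hk using Nat.le_induction with
  | base => exact hj
  | succ k hk ih =>
    rw [mem_ball_iff_norm] at ih ⊢
    exact (step_le wbar hmem k (hball _ (mem_ball_iff_norm.2
      (ih.trans_le (min_le_left _ _))))).trans_lt ih
end
end
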